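/- The top-elimination operators represent n_T: for all rooted trees T1, T2, E^top_{T1} ∘ E^top_{T2} − E^top_{T2} ∘ E^top_{T1} = Σ_T (a(T1,T2;T) − a(T2,T1;T))·E^top_T (sum over isomorphism classes of rooted trees T). Equivalently, the linear map n_T → End(H*) sending T ↦ E^top_T is a homomorphism of Lie algebras, so H* is a representation of n_T under top elimination. -/

import Mathlib

open scoped Classical

/-- Concrete (labeled) rooted trees: a root with a list of subtrees. -/
inductive RTree : Type
  | node : List RTree → RTree

/-- Shapes of admissible cuts: at each tree, either the full cut
(everything, including the root, goes to the pruned part `P`), or a choice of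
an admissible cut of each child subtree.  A `full` occurring strictly inside
corresponds to cutting the edge above that vertex. -/
inductive CutShape : Type
  | full
  | branch : List CutShape → CutShape

namespace CK

/-- Number of vertices of a forest. -/
def sizeL : List RTree → ℕ
  | [] => 0
  | .node l :: ts => 1 + sizeL l + sizeL ts

/-- All admissible cuts of a forest (a choice of admissible cut of each tree). -/
def cutsF : List RTree → List (List CutShape)
  | [] => [[]]
  | .node l :: ts =>
      (CutShape.full :: (cutsF l).map CutShape.branch).flatMap
        fun c => (cutsF ts).map (c :: ·)

/-- The root part `R_C(F)` of a cut. -/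
def Rcut : List RTree → List CutShape → List RTree
  | [], _ => []
  | _ :: _, [] => []
  | .node _ :: ts, .full :: cs => Rcut ts cs
  | .node l :: ts, .branch ds :: cs => RTree.node (Rcut l ds) :: Rcut ts cs

/-- The pruned part `P_C(F)` of a cut. -/
def Pcut : List RTree → List CutShape → List RTree
  | [], _ => []
  | _ :: _, [] => []
  | .node l :: ts, .full :: cs => RTree.node l :: Pcut ts cs
  | .node l :: ts, .branch ds :: cs => Pcut l ds ++ Pcut ts cs

/-- Number of `full`s occurring in a cut. -/
def fullsL : List CutShape → ℕ
  | [] => 0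
  | .full :: cs => 1 + fullsL cs
  | .branch ds :: cs => fullsL ds + fullsL cs

/-- A list of concrete forests containing (representatives of) every forest
with at most `n` vertices. -/
def forestsUpTo : ℕ → List (List RTree)
  | 0 => [[]]
  | n+1 => [] :: (forestsUpTo n).flatMap fun l => (forestsUpTo n).map fun F => RTree.node l :: F

/-- Isomorphism of rooted trees (non-planar): a root-preserving bijection, i.e.
the lists of subtrees agree up to permutation and isomorphism. -/
inductive Iso : RTree → RTree → Prop
  | node {l₁ l l₂ : List RTree} : List.Forall₂ Iso l₁ l → l.Perm l₂ → Iso (.node l₁) (.node l₂)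

/-- Isomorphism classes of rooted trees. -/
abbrev TreeClass : Type := Quot Iso

/-- Isomorphism classes of rooted forests = multisets of tree classes.
The empty forest is `0`. -/
abbrev ForestClass : Type := Multiset TreeClass

/-- Isomorphism class of a tree. -/
def clT (t : RTree) : TreeClass := Quot.mk _ t

/-- Isomorphism class of a forest. -/
def clF (F : List RTree) : ForestClass := (F.map clT : List TreeClass)

/-- A concrete representative of a forest class. -/
noncomputable def repF (M : ForestClass) : List RTree := M.toList.map Quot.out

/-- A concrete representative of a tree class. -/
noncomputable def repT (T : TreeClass) : RTree := T.out

/-- Number of vertices of a forest class. -/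
noncomputable def sizeC (M : ForestClass) : ℕ := sizeL (repF M)

/-- Number of vertices of a tree class. -/
noncomputable def sizeT (T : TreeClass) : ℕ := sizeL [repT T]

/-- The Hall algebra `H`: finitely supported ℚ-valued functions on
isomorphism classes of rooted forests, with basis the delta functions. -/
abbrev H : Type := ForestClass →₀ ℚ

/-- The basis element `δ_A` of `H`. -/
noncomputable def delta (A : ForestClass) : H := Finsupp.single A 1

/-- `n(A,B;M)`: the number of admissible cuts `C` of `M` with
`P_C(M) ≅ A` and `R_C(M) ≅ B`. -/
noncomputable def nCuts (A B M : ForestClass) : ℕ :=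
  (cutsF (repF M)).countP fun c =>
    decide (clF (Pcut (repF M) c) = A ∧ clF (Rcut (repF M) c) = B)

/-- A finite set of forest classes containing all classes with at most `n`
vertices. -/
noncomputable def forestCand (n : ℕ) : Finset ForestClass :=
  ((forestsUpTo n).map clF).toFinset

/-- A finite set of tree classes containing all classes with at most `n+1`
vertices. -/
noncomputable def treeCand (n : ℕ) : Finset TreeClass :=
  ((forestsUpTo n).map fun F => clT (RTree.node F)).toFinset

/-- The Hall product on basis elements: `δ_A × δ_B = Σ_M n(A,B;M)·δ_M`
(every `M` with `n(A,B;M) ≠ 0` has exactly `sizeC A + sizeC B` vertices). -/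
noncomputable def mulBasis (A B : ForestClass) : H :=
  ∑ M ∈ forestCand (sizeC A + sizeC B), (nCuts A B M : ℚ) • delta M

/-- The Hall product on `H`, extended bilinearly from basis elements. -/
noncomputable def hmul (f g : H) : H :=
  f.sum fun A a => g.sum fun B b => (a * b) • mulBasis A B

/-- The Connes-Kreimer Lie algebra `n_T` (as a vector space): the span of
isomorphism classes of rooted trees. -/
abbrev nT : Type := TreeClass →₀ ℚ

/-- The basis element of `n_T` corresponding to a rooted tree `T`. -/
noncomputable def tau (T : TreeClass) : nT := Finsupp.single T 1

/-- `a(T₁,T₂;T)`: the number of edges `e` of `T` such that the single-edge cut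
at `e` has pruned part `≅ T₁` and root part `≅ T₂`. -/
noncomputable def aCount (T₁ T₂ T : TreeClass) : ℕ :=
  (cutsF [repT T]).countP fun c =>
    decide (fullsL c = 1 ∧ clF (Pcut [repT T] c) = ({T₁} : Multiset TreeClass)
      ∧ clF (Rcut [repT T] c) = ({T₂} : Multiset TreeClass))

/-- The grafting (pre-Lie) product on basis elements:
`T₁ * T₂ = Σ_T a(T₁,T₂;T)·T`. -/
noncomputable def graftBasis (T₁ T₂ : TreeClass) : nT :=
  ∑ T ∈ treeCand (sizeT T₁ + sizeT T₂), (aCount T₁ T₂ T : ℚ) • tau T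

/-- The grafting (pre-Lie) product on `n_T`, extended bilinearly. -/
noncomputable def graft (x y : nT) : nT :=
  x.sum fun T₁ a => y.sum fun T₂ b => (a * b) • graftBasis T₁ T₂

/-- The Connes-Kreimer bracket `[x,y] = x*y - y*x` on `n_T`. -/
noncomputable def ckBracket (x y : nT) : nT := graft x y - graft y x

/-- `Ẽ_A δ_B = Σ_C δ_{R_C(B)}`, the sum over admissible cuts `C` of `B` with
`P_C(B) ≅ A`. -/
noncomputable def elimBasis (A B : ForestClass) : H :=
  (((cutsF (repF B)).filter fun c => decide (clF (Pcut (repF B) c) = A)).map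
    fun c => delta (clF (Rcut (repF B) c))).sum

/-- The elimination operator `E_A` (here on `H ≅ H*`, identifying `φ_B` with
`δ_B`). -/
noncomputable def elim (A : ForestClass) : H →ₗ[ℚ] H :=
  Finsupp.lsum ℚ fun B => LinearMap.toSpanSingleton ℚ H (elimBasis A B)

/-- `Ẽ^top_A δ_B = Σ_C δ_{P_C(B)}`, the sum over admissible cuts `C` of `B`
with `R_C(B) ≅ A`. -/
noncomputable def topElimBasis (A B : ForestClass) : H :=
  (((cutsF (repF B)).filter fun c => decide (clF (Rcut (repF B) c) = A)).map
    fun c => delta (clF (Pcut (repF B) c))).sum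

/-- The top-elimination operator `E^top_A`. -/
noncomputable def topElim (A : ForestClass) : H →ₗ[ℚ] H :=
  Finsupp.lsum ℚ fun B => LinearMap.toSpanSingleton ℚ H (topElimBasis A B)

/-- `H ⊗ H`, realized as finitely supported functions on pairs of classes. -/
abbrev H2 : Type := (ForestClass × ForestClass) →₀ ℚ

/-- `Δ(δ_M) = Σ δ_A ⊗ δ_B`, the sum over ordered pairs `(A,B)` of classes with
`A ⊔ B ≅ M`. -/
noncomputable def deltaBasis (M : ForestClass) : H2 :=
  ∑ A ∈ M.powerset.toFinset, Finsupp.single (A, M - A) 1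

/-- The coproduct `Δ : H → H ⊗ H`. -/
noncomputable def coprod : H →ₗ[ℚ] H2 :=
  Finsupp.lsum ℚ fun M => LinearMap.toSpanSingleton ℚ H2 (deltaBasis M)

/-- The linear map `n_T → End(H*)` sending a rooted tree `T` to `E^top_T`. -/
noncomputable def rhoTop : nT →ₗ[ℚ] (H →ₗ[ℚ] H) :=
  Finsupp.lsum ℚ fun T =>
    LinearMap.toSpanSingleton ℚ (H →ₗ[ℚ] H) (topElim ({T} : Multiset TreeClass))

/-! ### Sums over admissible cuts -/

/-- Sum over the admissible cuts of `F` of a function of the pruned and the root part. -/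
noncomputable def cutSum {M : Type*} [AddCommMonoid M] (F : List RTree)
    (f : ForestClass → ForestClass → M) : M :=
  ((cutsF F).map fun c => f (clF (Pcut F c)) (clF (Rcut F c))).sum

/-- Sum over the admissible cuts of a forest class. -/
noncomputable def cutSumC {M : Type*} [AddCommMonoid M] (A : ForestClass)
    (f : ForestClass → ForestClass → M) : M := cutSum (repF A) f

/-- Grafting a forest class on a new root. -/
noncomputable def rootOn (A : ForestClass) : TreeClass := clT (RTree.node (repF A))

theorem forall2_iso_refl (l : List RTree) : List.Forall₂ Iso l l := by
  induction l using sizeL.induct with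
  | case1 => exact List.Forall₂.nil
  | case2 l ts ih1 ih2 => exact List.Forall₂.cons (Iso.node ih1 (List.Perm.refl _)) ih2

theorem clT_node_perm {l l' : List RTree} (h : l.Perm l') :
    clT (.node l) = clT (.node l') :=
  Quot.sound (Iso.node (forall2_iso_refl l) h)

theorem clT_node_congr {t t' : RTree} (h : clT t = clT t') (a b : List RTree) :
    clT (.node (a ++ t :: b)) = clT (.node (a ++ t' :: b)) := by
  have h' := Quot.eqvGen_exact h
  clear h
  induction h' with
  | rel x y hxy =>
    exact Quot.sound (Iso.node (List.rel_append (forall2_iso_refl a)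
      (List.Forall₂.cons hxy (forall2_iso_refl b))) (List.Perm.refl _))
  | refl x => rfl
  | symm x y _ ih => exact ih.symm
  | trans x y z _ _ ih1 ih2 => exact ih1.trans ih2

theorem clT_out (T : TreeClass) : clT (Quot.out T) = T := Quot.out_eq T

theorem clT_node_out (l : List RTree) : ∀ a : List RTree,
    clT (.node (a ++ l)) = clT (.node (a ++ (l.map clT).map Quot.out)) := by
  induction l with
  | nil => intro a; rfl
  | cons t l ih =>
    intro a
    have h1 := ih (a ++ [t])
    have h2 := clT_node_congr (clT_out (clT t)).symm a ((l.map clT).map Quot.out)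
    simp only [List.append_assoc, List.singleton_append] at h1
    rw [h1, h2]
    rfl

theorem clF_eq_perm {F G : List RTree} (h : clF F = clF G) :
    ((F.map clT).map Quot.out).Perm ((G.map clT).map (Quot.out (r := Iso))) :=
  (Multiset.coe_eq_coe.mp h).map _

theorem clT_node_of_clF {F G : List RTree} (h : clF F = clF G) :
    clT (.node F) = clT (.node G) := by
  have h1 := clT_node_out F []
  have h2 := clT_node_out G []
  simp only [List.nil_append] at h1 h2
  rw [h1, h2]
  exact clT_node_perm (clF_eq_perm h)

theorem clF_repF (A : ForestClass) : clF (repF A) = A := by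
  unfold clF repF
  rw [List.map_map]
  have : (clT ∘ Quot.out : TreeClass → TreeClass) = id := funext clT_out
  rw [this, List.map_id]
  exact Multiset.coe_toList A

theorem clT_node (l : List RTree) : clT (.node l) = rootOn (clF l) :=
  clT_node_of_clF (clF_repF _).symm

theorem clF_nil : clF [] = 0 := rfl

theorem clF_cons (t : RTree) (F : List RTree) : clF (t :: F) = {clT t} + clF F := rfl

theorem clF_append (F G : List RTree) : clF (F ++ G) = clF F + clF G := by
  simp [clF]

theorem card_clF (F : List RTree) : Multiset.card (clF F) = F.length := by simp [clF]

section
variable {M : Type*} [AddCommMonoid M]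

theorem cutSum_nil (f : ForestClass → ForestClass → M) : cutSum [] f = f 0 0 := by
  simp [cutSum, cutsF, Pcut, Rcut, clF_nil]

theorem cutSum_add (F : List RTree) (f g : ForestClass → ForestClass → M) :
    cutSum F (fun p r => f p r + g p r) = cutSum F f + cutSum F g := by
  simp [cutSum, List.sum_map_add]

theorem cutSum_zero (F : List RTree) :
    cutSum F (fun _ _ => (0 : M)) = 0 := by
  simp [cutSum]

theorem map_cutSum {N : Type*} [AddCommMonoid N] (φ : M →+ N) (F : List RTree)
    (f : ForestClass → ForestClass → M) :
    φ (cutSum F f) = cutSum F (fun p r => φ (f p r)) := by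
  simp [cutSum, map_list_sum, List.map_map, Function.comp_def]

theorem cutSum_comm (F G : List RTree)
    (f : ForestClass → ForestClass → ForestClass → ForestClass → M) :
    cutSum F (fun p r => cutSum G (fun p' r' => f p r p' r'))
      = cutSum G (fun p' r' => cutSum F (fun p r => f p r p' r')) := by
  unfold cutSum
  have := Multiset.sum_map_sum_map (cutsF F : Multiset (List CutShape)) (cutsF G)
    (f := fun c d => f (clF (Pcut F c)) (clF (Rcut F c)) (clF (Pcut G d)) (clF (Rcut G d)))
  simpa only [Multiset.map_coe, Multiset.sum_coe] using this

theorem cutSum_cons (l ts : List RTree) (f : ForestClass → ForestClass → M) :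
    cutSum (.node l :: ts) f =
      cutSum ts (fun p r => f ({clT (.node l)} + p) r)
      + cutSum l (fun p r => cutSum ts (fun p' r' => f (p + p') ({rootOn r} + r'))) := by
  simp only [cutSum, cutsF, List.flatMap_cons, List.map_append, List.sum_append, List.map_map,
    Function.comp_def, Pcut, Rcut, clF_cons]
  congr 1
  rw [List.flatMap_map]
  generalize cutsF l = L
  induction L with
  | nil => simp
  | cons c L ih =>
    rw [List.flatMap_cons, List.map_append, List.sum_append, ih, List.map_cons, List.sum_cons]
    simp only [List.map_map, Function.comp_def, Pcut, Rcut, clF_cons, clF_append, clT_node]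

theorem cutSum_single (l : List RTree) (f : ForestClass → ForestClass → M) :
    cutSum [.node l] f = f {clT (.node l)} 0 + cutSum l (fun p r => f p {rootOn r}) := by
  simp [cutSum_cons, cutSum_nil]

theorem cutSum_cons' (t : RTree) (ts : List RTree) (f : ForestClass → ForestClass → M) :
    cutSum (t :: ts) f =
      cutSum [t] (fun p r => cutSum ts (fun p' r' => f (p + p') (r + r'))) := by
  cases t
  simp [cutSum_cons, cutSum_nil]

theorem cutSum_perm {F G : List RTree} (h : F.Perm G) :
    ∀ f : ForestClass → ForestClass → M, cutSum F f = cutSum G f := by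
  induction h with
  | nil => intro f; rfl
  | @cons t l₁ l₂ _ ih => intro f; rw [cutSum_cons' t l₁, cutSum_cons' t l₂]; simp only [ih]
  | swap a b l =>
    intro f
    rw [cutSum_cons' b, cutSum_cons' a]
    simp only [cutSum_cons' a l, cutSum_cons' b l]
    rw [cutSum_comm]
    simp only [add_left_comm]
  | trans _ _ ih1 ih2 => intro f; rw [ih1, ih2]

theorem cutSum_iso (F : List RTree) : ∀ G : List RTree, List.Forall₂ Iso F G →
    ∀ f : ForestClass → ForestClass → M, cutSum F f = cutSum G f := by
  induction F using sizeL.induct with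
  | case1 => intro G h f; cases h; rfl
  | case2 l ts ih1 ih2 =>
    intro G h f
    cases h with
    | @cons _ t' _ ts' h1 h2 =>
      have hc : clT (.node l) = clT t' := Quot.sound h1
      cases h1 with
      | node ha hp =>
        rw [cutSum_cons, cutSum_cons, hc, ih1 _ ha, cutSum_perm hp]
        simp only [ih2 _ h2]

theorem cutSum_clT {t t' : RTree} (h : clT t = clT t') (f : ForestClass → ForestClass → M) :
    cutSum [t] f = cutSum [t'] f := by
  have h' := Quot.eqvGen_exact h
  clear h
  induction h' with
  | rel x y hxy => exact cutSum_iso _ _ (List.Forall₂.cons hxy List.Forall₂.nil) f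
  | refl x => rfl
  | symm x y _ ih => exact ih.symm
  | trans x y z _ _ ih1 ih2 => exact ih1.trans ih2

theorem cutSum_out (F : List RTree) : ∀ f : ForestClass → ForestClass → M,
    cutSum F f = cutSum ((F.map clT).map Quot.out) f := by
  induction F with
  | nil => intro f; rfl
  | cons t F ih =>
    intro f
    rw [cutSum_cons', List.map_cons, List.map_cons, cutSum_cons' (Quot.out (clT t)),
      cutSum_clT (clT_out (clT t)).symm]
    simp only [ih]

theorem cutSum_clF (F : List RTree) (f : ForestClass → ForestClass → M) :
    cutSum F f = cutSumC (clF F) f := by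
  unfold cutSumC
  rw [cutSum_out F, cutSum_out (repF _)]
  exact cutSum_perm (clF_eq_perm (clF_repF _).symm) f

theorem cutSumC_node (l : List RTree) (A : ForestClass) (f : ForestClass → ForestClass → M) :
    cutSumC ({clT (.node l)} + A) f =
      cutSumC A (fun p r => f ({clT (.node l)} + p) r)
      + cutSum l (fun p r => cutSumC A (fun p' r' => f (p + p') ({rootOn r} + r'))) := by
  have h : clF (.node l :: repF A) = {clT (.node l)} + A := by rw [clF_cons, clF_repF]
  rw [← h, ← cutSum_clF, cutSum_cons]
  rfl

theorem cutSumC_rootOn (B A : ForestClass) (f : ForestClass → ForestClass → M) :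
    cutSumC ({rootOn B} + A) f =
      cutSumC A (fun p r => f ({rootOn B} + p) r)
      + cutSumC B (fun p r => cutSumC A (fun p' r' => f (p + p') ({rootOn r} + r'))) :=
  cutSumC_node (repF B) A f

theorem cutSumC_zero (f : ForestClass → ForestClass → M) : cutSumC 0 f = f 0 0 := by
  have h := cutSum_clF [] f
  rw [cutSum_nil, clF_nil] at h
  exact h.symm

theorem cutSumC_add (A B : ForestClass) (f : ForestClass → ForestClass → M) :
    cutSumC (A + B) f =
      cutSumC A (fun p r => cutSumC B (fun p' r' => f (p + p') (r + r'))) := by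
  have key : ∀ F : List RTree, ∀ f : ForestClass → ForestClass → M,
      cutSumC (clF F + B) f =
        cutSumC (clF F) (fun p r => cutSumC B (fun p' r' => f (p + p') (r + r'))) := by
    intro F
    induction F with
    | nil => intro f; simp [clF_nil, cutSumC_zero]
    | cons t F ih =>
      intro f
      cases t with
      | node l =>
        rw [clF_cons, add_assoc, cutSumC_node, cutSumC_node]
        simp only [ih, add_assoc]
  have := key (repF A) f
  rwa [clF_repF] at this

/-- Coassociativity. -/
theorem cutSum_coassoc (F : List RTree) :
    ∀ f : ForestClass → ForestClass → ForestClass → M,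
    cutSum F (fun p r => cutSumC p (fun p' r' => f p' r' r))
      = cutSum F (fun p r => cutSumC r (fun p' r' => f p p' r')) := by
  induction F using sizeL.induct with
  | case1 => intro f; simp [cutSum_nil, cutSumC_zero]
  | case2 l ts ih1 ih2 =>
    intro f
    rw [cutSum_cons, cutSum_cons]
    simp only [cutSumC_node, cutSumC_rootOn, cutSum_add]
    simp only [cutSumC_add]
    rw [ih2 (fun a b r => f ({clT (.node l)} + a) b r), add_assoc]
    congr 1
    congr 1
    · have h : ∀ p r, cutSum l (fun a b => cutSumC p (fun a' b' =>
          f (a + a') ({rootOn b} + b') r)) = cutSum l (fun a b => cutSum (repF p) (fun a' b' =>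
          f (a + a') ({rootOn b} + b') r)) := fun _ _ => rfl
      rw [cutSum_comm]
      congr 1
      funext a b
      exact ih2 (fun a' b' r => f (a + a') ({rootOn b} + b') r)
    · have h : ∀ p r, cutSum ts (fun p' r' => cutSumC p (fun a b => cutSumC p' (fun a' b' =>
          f (a + a') (b + b') ({rootOn r} + r'))))
          = cutSumC p (fun a b => cutSum ts (fun p' r' => cutSumC r' (fun a' b' =>
            f (a + p') (b + a') ({rootOn r} + b')))) := by
        intro p r
        unfold cutSumC
        rw [cutSum_comm]
        congr 1
        funext a b
        exact ih2 (fun a' b' r' => f (a + a') (b + b') ({rootOn r} + r'))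
      simp only [h]
      rw [ih1 (fun a b r => cutSum ts (fun p' r' => cutSumC r' (fun a' b' =>
            f (a + p') (b + a') ({rootOn r} + b'))))]
      congr 1
      funext p r
      unfold cutSumC
      rw [cutSum_comm]

/-- There is exactly one cut with empty pruned part. -/
theorem cutSum_empty (F : List RTree) : ∀ g : ForestClass → M,
    cutSum F (fun p r => if p = 0 then g r else 0) = g (clF F) := by
  induction F using sizeL.induct with
  | case1 => intro g; simp [cutSum_nil, clF_nil]
  | case2 l ts ih1 ih2 =>
    intro g
    rw [cutSum_cons]
    have h1 : ∀ p : ForestClass, ¬ (({clT (.node l)} : ForestClass) + p = 0) := by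
      intro p h; simpa using congrArg Multiset.card h
    have h2 : ∀ p p' : ForestClass, (p + p' = 0) ↔ (p = 0 ∧ p' = 0) := by
      intro p p'; exact add_eq_zero
    simp only [h1, if_false, cutSum_zero, zero_add, h2, ite_and]
    have h3 : ∀ p r : ForestClass, cutSum ts (fun p' r' => if p = 0 then
        (if p' = 0 then g ({rootOn r} + r') else 0) else 0)
        = if p = 0 then g ({rootOn r} + clF ts) else 0 := by
      intro p r
      by_cases hp : p = 0
      · simp only [hp, if_true]; exact ih2 (fun r' => g ({rootOn r} + r'))
      · simp only [hp, if_false, cutSum_zero]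
    simp only [h3]
    rw [ih1 (fun r => g ({rootOn r} + clF ts)), ← clT_node, clF_cons]

end

/-! ### Numerical facts on cuts -/

theorem cut_facts (F : List RTree) : ∀ c ∈ cutsF F,
    (Pcut F c).length = fullsL c ∧ F.length ≤ (Pcut F c).length + (Rcut F c).length ∧
    sizeL (Pcut F c) + sizeL (Rcut F c) = sizeL F := by
  have happ : ∀ F G : List RTree, sizeL (F ++ G) = sizeL F + sizeL G := by
    intro F G
    induction F with
    | nil => simp [sizeL]
    | cons t F ih => cases t; simp [sizeL, ih, add_assoc]
  induction F using sizeL.induct with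
  | case1 => intro c hc; simp [cutsF] at hc; subst hc; simp [Pcut, Rcut, fullsL, sizeL]
  | case2 l ts ih1 ih2 =>
    intro c hc
    simp only [cutsF, List.mem_flatMap, List.mem_cons, List.mem_map] at hc
    obtain ⟨a, ha, d, hd, rfl⟩ := hc
    obtain ⟨i1, i2, i3⟩ := ih2 d hd
    rcases ha with rfl | ⟨e, he, rfl⟩
    · simp only [Pcut, Rcut, fullsL, sizeL, List.length_cons]
      omega
    · obtain ⟨j1, j2, j3⟩ := ih1 e he
      simp only [Pcut, Rcut, fullsL, sizeL, List.length_cons, List.length_append, happ]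
      omega

theorem sizeL_perm {F G : List RTree} (h : F.Perm G) : sizeL F = sizeL G := by
  induction h with
  | nil => rfl
  | cons t _ ih => cases t; simp [sizeL, ih]
  | swap a b l => cases a; cases b; simp only [sizeL]; omega
  | trans _ _ ih1 ih2 => rw [ih1, ih2]

theorem sizeL_iso (F : List RTree) : ∀ G : List RTree, List.Forall₂ Iso F G →
    sizeL F = sizeL G := by
  induction F using sizeL.induct with
  | case1 => intro G h; cases h; rfl
  | case2 l ts ih1 ih2 =>
    intro G h
    cases h with
    | cons h1 h2 =>
      cases h1 with
      | node ha hp => simp only [sizeL]; rw [ih1 _ ha, sizeL_perm hp, ih2 _ h2]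

theorem sizeL_clT {t t' : RTree} (h : clT t = clT t') : sizeL [t] = sizeL [t'] := by
  have h' := Quot.eqvGen_exact h
  clear h
  induction h' with
  | rel x y hxy => exact sizeL_iso _ _ (List.Forall₂.cons hxy List.Forall₂.nil)
  | refl x => rfl
  | symm x y _ ih => exact ih.symm
  | trans x y z _ _ ih1 ih2 => exact ih1.trans ih2

theorem sizeL_of_clF_single {F : List RTree} {T : TreeClass} (h : clF F = {T}) :
    sizeL F = sizeT T := by
  have hl : F.length = 1 := by rw [← card_clF, h, Multiset.card_singleton]
  obtain ⟨t, rfl⟩ := List.length_eq_one_iff.mp hl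
  have ht : clT t = T := by simpa [clF] using h
  exact sizeL_clT (ht.trans (clT_out T).symm)

theorem mem_forestsUpTo (n : ℕ) : ∀ F : List RTree, sizeL F ≤ n → F ∈ forestsUpTo n := by
  induction n with
  | zero =>
    intro F h
    match F, h with
    | [], _ => simp [forestsUpTo]
    | .node l :: ts, h => simp only [sizeL] at h; omega
  | succ n ih =>
    intro F h
    match F, h with
    | [], _ => simp [forestsUpTo]
    | .node l :: ts, h =>
      simp only [sizeL] at h
      simp only [forestsUpTo, List.mem_cons, List.mem_flatMap, List.mem_map]
      exact Or.inr ⟨l, ih l (by omega), ts, ih ts (by omega), rfl⟩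

theorem repF_single (T : TreeClass) : repF {T} = [repT T] := by
  simp [repF, repT]

theorem aCount_eq_nCuts (T₁ T₂ T : TreeClass) : aCount T₁ T₂ T = nCuts {T₁} {T₂} {T} := by
  unfold aCount nCuts
  rw [repF_single]
  apply List.countP_congr
  intro c hc
  simp only [decide_eq_true_eq]
  constructor
  · rintro ⟨_, h⟩; exact h
  · intro h
    refine ⟨?_, h⟩
    rw [← (cut_facts _ c hc).1, ← card_clF, h.1, Multiset.card_singleton]

theorem mem_treeCand_of_aCount {T₁ T₂ T : TreeClass} (h : aCount T₁ T₂ T ≠ 0) :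
    T ∈ treeCand (sizeT T₁ + sizeT T₂) := by
  unfold aCount at h
  obtain ⟨c, hc, hp⟩ := List.countP_pos_iff.mp (Nat.pos_of_ne_zero h)
  simp only [decide_eq_true_eq] at hp
  have h3 := (cut_facts _ c hc).2.2
  rw [sizeL_of_clF_single hp.2.1, sizeL_of_clF_single hp.2.2] at h3
  rcases hT : repT T with ⟨l⟩
  rw [hT] at h3
  simp only [sizeL] at h3
  unfold treeCand
  rw [List.mem_toFinset, List.mem_map]
  refine ⟨l, mem_forestsUpTo _ _ (by omega), ?_⟩
  rw [← hT]; exact clT_out T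

theorem nCuts_smul {M : Type*} [AddCommMonoid M] [Module ℚ M] (A B Y : ForestClass) (x : M) :
    cutSumC Y (fun p r => if p = A ∧ r = B then x else 0) = (nCuts A B Y : ℚ) • x := by
  unfold cutSumC cutSum nCuts
  generalize cutsF (repF Y) = L
  induction L with
  | nil => simp
  | cons c L ih =>
    rw [List.map_cons, List.sum_cons, ih, List.countP_cons]
    by_cases h : clF (Pcut (repF Y) c) = A ∧ clF (Rcut (repF Y) c) = B
    · simp [h, add_smul, add_comm]
    · simp [h]

theorem nCuts_cast (A B Y : ForestClass) :
    (nCuts A B Y : ℚ) = cutSumC Y (fun p r => if p = A ∧ r = B then (1 : ℚ) else 0) := by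
  rw [nCuts_smul]; simp

/-- On two trees the count is explicit. -/
theorem cutSum_pair (l m : List RTree) (T₁ T₂ : TreeClass) :
    cutSum [.node l, .node m]
      (fun p r => if p = ({T₁} : ForestClass) ∧ r = ({T₂} : ForestClass) then (1 : ℚ) else 0)
    = (if clT (.node l) = T₁ ∧ clT (.node m) = T₂ then 1 else 0)
      + (if clT (.node m) = T₁ ∧ clT (.node l) = T₂ then 1 else 0) := by
  rw [cutSum_cons, cutSum_single]
  simp only [cutSum_single]
  have e0 : ∀ T : TreeClass, ¬ ((0 : ForestClass) = {T}) := by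
    intro T h; simpa using congrArg Multiset.card h
  have e2 : ∀ a b T : TreeClass, ¬ (({a} : ForestClass) + {b} = {T}) := by
    intro a b T h; simpa using congrArg Multiset.card h
  have e1 : ∀ (a : TreeClass) (p : ForestClass) (T : TreeClass),
      (({a} : ForestClass) + p = {T}) ↔ (p = 0 ∧ a = T) := by
    intro a p T
    constructor
    · intro h
      have hc := congrArg Multiset.card h
      have hp : p = 0 := by
        rw [← Multiset.card_eq_zero]
        rw [Multiset.card_add, Multiset.card_singleton, Multiset.card_singleton] at hc; omega
      subst hp
      exact ⟨rfl, by simpa using h⟩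
    · rintro ⟨rfl, rfl⟩; simp
  have e1' : ∀ (a : TreeClass) (p : ForestClass) (T : TreeClass),
      (p + ({a} : ForestClass) = {T}) ↔ (p = 0 ∧ a = T) := by
    intro a p T; rw [add_comm, e1]
  simp only [e0, e2, and_false, if_false, zero_add, add_zero, cutSum_zero, e1, e1', and_assoc,
    Multiset.singleton_inj]
  have k : ∀ (n : List RTree) (a : TreeClass), cutSum n (fun p r =>
      if p = 0 ∧ a = T₁ ∧ rootOn r = T₂ then (1 : ℚ) else 0)
      = if a = T₁ ∧ clT (.node n) = T₂ then 1 else 0 := by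
    intro n a
    have := cutSum_empty n (fun r => if a = T₁ ∧ rootOn r = T₂ then (1 : ℚ) else 0)
    rw [clT_node, ← this]
    simp only [ite_and]
  simp [k]

theorem nCuts_symm (T₁ T₂ : TreeClass) (Y : ForestClass) (h : Multiset.card Y ≠ 1) :
    (nCuts {T₁} {T₂} Y : ℚ) = nCuts {T₂} {T₁} Y := by
  have hlen : (repF Y).length = Multiset.card Y := by rw [← card_clF, clF_repF]
  rw [nCuts_cast, nCuts_cast]
  unfold cutSumC
  have big : ∀ (F : List RTree), F.length ≠ 1 → ∀ T₁ T₂ : TreeClass,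
      cutSum F (fun p r => if p = ({T₁} : ForestClass) ∧ r = ({T₂} : ForestClass)
        then (1 : ℚ) else 0)
      = cutSum F (fun p r => if p = ({T₂} : ForestClass) ∧ r = ({T₁} : ForestClass)
        then (1 : ℚ) else 0) := by
    intro F hF T₁ T₂
    match F, hF with
    | [], _ => simp [cutSum_nil]
    | [_], hF => simp at hF
    | [.node l, .node m], _ =>
      rw [cutSum_pair, cutSum_pair, add_comm]
      simp only [and_comm]
    | a :: b :: c :: F, _ =>
      have z : ∀ T₁ T₂ : TreeClass, cutSum (a :: b :: c :: F)
          (fun p r => if p = ({T₁} : ForestClass) ∧ r = ({T₂} : ForestClass)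
            then (1 : ℚ) else 0) = 0 := by
        intro T₁ T₂
        unfold cutSum
        apply List.sum_eq_zero
        intro x hx
        obtain ⟨d, hd, rfl⟩ := List.mem_map.mp hx
        refine if_neg ?_
        rintro ⟨h1, h2⟩
        have := (cut_facts _ d hd).2.1
        rw [← card_clF (Pcut _ d), ← card_clF (Rcut _ d), h1, h2] at this
        simp at this
      rw [z, z]
  exact big _ (by rw [hlen]; exact h) _ _

theorem topElimBasis_eq (A B : ForestClass) :
    topElimBasis A B = cutSumC B (fun p r => if r = A then delta p else 0) := by
  unfold topElimBasis cutSumC cutSum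
  generalize cutsF (repF B) = L
  induction L with
  | nil => simp
  | cons c L ih =>
    by_cases h : clF (Rcut (repF B) c) = A
    · simp [h] at ih ⊢; exact ih
    · simp [h] at ih ⊢; exact ih

theorem topElim_delta (A B : ForestClass) :
    topElim A (delta B) = cutSumC B (fun p r => if r = A then delta p else 0) := by
  rw [← topElimBasis_eq]
  simp [topElim, delta]

theorem topElim_comp_delta (A A' B : ForestClass) :
    topElim A (topElim A' (delta B)) =
      cutSumC B (fun p r => (nCuts A A' r : ℚ) • delta p) := by
  rw [topElim_delta]
  have h := cutSum_coassoc (repF B) (fun x y z => if y = A ∧ z = A' then delta x else 0)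
  simp only [nCuts_smul] at h
  unfold cutSumC at h ⊢
  rw [← h]
  have := map_cutSum (topElim A).toAddMonoidHom (repF B)
    (fun p r => if r = A' then delta p else 0)
  refine this.trans ?_
  congr 1
  funext p r
  by_cases hr : r = A'
  · simp only [hr, if_true, and_true]
    exact topElim_delta A p
  · simp [hr, cutSum_zero]

theorem nCuts_sub (T₁ T₂ : TreeClass) (Y : ForestClass) (x : H) :
    (nCuts {T₁} {T₂} Y : ℚ) • x - (nCuts {T₂} {T₁} Y : ℚ) • x =
      ∑ T ∈ treeCand (sizeT T₁ + sizeT T₂),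
        ((aCount T₁ T₂ T : ℚ) - (aCount T₂ T₁ T : ℚ)) • (if Y = {T} then x else 0) := by
  by_cases h : Multiset.card Y = 1
  · obtain ⟨T, rfl⟩ := Multiset.card_eq_one.mp h
    simp only [Multiset.singleton_inj, smul_ite, smul_zero, Finset.sum_ite_eq,
      ← aCount_eq_nCuts, ← sub_smul]
    split_ifs with hm
    · rfl
    · have h1 : aCount T₁ T₂ T = 0 := by
        by_contra hc; exact hm (mem_treeCand_of_aCount hc)
      have h2 : aCount T₂ T₁ T = 0 := by
        by_contra hc; exact hm (by rw [add_comm]; exact mem_treeCand_of_aCount hc)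
      simp [h1, h2]
  · rw [nCuts_symm T₁ T₂ Y h, sub_self]
    symm
    apply Finset.sum_eq_zero
    intro T _
    rw [if_neg, smul_zero]
    rintro rfl
    simp at h

theorem topElim_commutator (T₁ T₂ : TreeClass) :
    topElim ({T₁} : Multiset TreeClass) ∘ₗ topElim ({T₂} : Multiset TreeClass)
          - topElim ({T₂} : Multiset TreeClass) ∘ₗ topElim ({T₁} : Multiset TreeClass)
        = ∑ T ∈ treeCand (sizeT T₁ + sizeT T₂),
            ((aCount T₁ T₂ T : ℚ) - (aCount T₂ T₁ T : ℚ))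
              • topElim ({T} : Multiset TreeClass) := by
  apply Finsupp.lhom_ext'
  intro B
  apply LinearMap.ext_ring
  change topElim {T₁} (topElim {T₂} (delta B)) - topElim {T₂} (topElim {T₁} (delta B))
    = (∑ T ∈ treeCand (sizeT T₁ + sizeT T₂),
            ((aCount T₁ T₂ T : ℚ) - (aCount T₂ T₁ T : ℚ))
              • topElim ({T} : Multiset TreeClass)) (delta B)
  rw [topElim_comp_delta, topElim_comp_delta, LinearMap.sum_apply]
  simp only [LinearMap.smul_apply, topElim_delta]
  rw [sub_eq_iff_eq_add]
  have hs : ∀ (s : Finset TreeClass) (w : TreeClass → ℚ),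
      ∑ T ∈ s, w T • cutSumC B (fun p r => if r = {T} then delta p else 0)
      = cutSumC B (fun p r => ∑ T ∈ s, w T • (if r = {T} then delta p else (0 : H))) := by
    intro s w
    induction s using Finset.induction_on with
    | empty => simp [cutSumC, cutSum_zero]
    | insert a s ha ih =>
      simp only [Finset.sum_insert ha, ih]
      unfold cutSumC
      rw [cutSum_add]
      congr 1
      exact map_cutSum (DistribSMul.toAddMonoidHom H (w a)) (repF B) _
  rw [hs]
  unfold cutSumC
  rw [← cutSum_add]
  congr 1
  funext p r
  rw [← nCuts_sub, sub_add_cancel]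

theorem rhoTop_tau (T : TreeClass) : rhoTop (tau T) = topElim {T} := by
  simp [rhoTop, tau]

theorem rhoTop_graftBasis_sub (T₁ T₂ : TreeClass) (v : H) :
    rhoTop (graftBasis T₁ T₂) v - rhoTop (graftBasis T₂ T₁) v =
      topElim {T₁} (topElim {T₂} v) - topElim {T₂} (topElim {T₁} v) := by
  have h := LinearMap.congr_fun (topElim_commutator T₁ T₂) v
  refine Eq.trans ?_ h.symm
  unfold graftBasis
  rw [add_comm (sizeT T₂)]
  simp only [map_sum, map_smul, rhoTop_tau, LinearMap.sum_apply, LinearMap.smul_apply]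
  rw [← Finset.sum_sub_distrib]
  exact Finset.sum_congr rfl fun T _ => (sub_smul _ _ _).symm

theorem rhoTop_bracket (x y : nT) :
    rhoTop (ckBracket x y) = rhoTop x ∘ₗ rhoTop y - rhoTop y ∘ₗ rhoTop x := by
  apply LinearMap.ext
  intro v
  have hr : ∀ (x : nT) (v : H), rhoTop x v = ∑ T ∈ x.support, x T • topElim {T} v := by
    intro x v
    have : rhoTop x = ∑ T ∈ x.support, x T • topElim {T} := rfl
    rw [this, LinearMap.sum_apply]
    rfl
  have e1 : ∀ x y : nT, rhoTop (graft x y) v =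
      ∑ T₁ ∈ x.support, ∑ T₂ ∈ y.support, (x T₁ * y T₂) • rhoTop (graftBasis T₁ T₂) v := by
    intro x y
    simp only [graft, Finsupp.sum, map_sum, map_smul, LinearMap.sum_apply, LinearMap.smul_apply]
  have e3 : ∀ x y : nT, rhoTop x (rhoTop y v) =
      ∑ T₁ ∈ x.support, ∑ T₂ ∈ y.support,
        (x T₁ * y T₂) • topElim {T₁} (topElim {T₂} v) := by
    intro x y
    rw [hr y, hr x]
    simp only [map_sum, map_smul, Finset.smul_sum, smul_smul]
  have e5 : rhoTop (ckBracket x y) v = rhoTop (graft x y) v - rhoTop (graft y x) v := by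
    unfold ckBracket
    rw [map_sub]
    rfl
  change _ = rhoTop x (rhoTop y v) - rhoTop y (rhoTop x v)
  rw [e5, e1 x y, e1 y x, e3 x y, e3 y x,
    Finset.sum_comm (s := y.support), Finset.sum_comm (s := y.support)]
  rw [← Finset.sum_sub_distrib, ← Finset.sum_sub_distrib]
  refine Finset.sum_congr rfl fun T₁ _ => ?_
  rw [← Finset.sum_sub_distrib, ← Finset.sum_sub_distrib]
  refine Finset.sum_congr rfl fun T₂ _ => ?_
  rw [mul_comm (y T₂), ← smul_sub, ← smul_sub, rhoTop_graftBasis_sub]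

/-- STATEMENT 11: the top-elimination operators represent `n_T`: for all
rooted trees `T₁, T₂`,
`E^top_{T₁}∘E^top_{T₂} − E^top_{T₂}∘E^top_{T₁} = Σ_T (a(T₁,T₂;T) − a(T₂,T₁;T))·E^top_T`
(sum over isomorphism classes of rooted trees `T`; it is supported on trees
with `|T₁| + |T₂|` vertices, hence captured by the candidate set).
Equivalently, `T ↦ E^top_T` is a homomorphism of Lie algebras, so `H*` is a
representation of `n_T` under top elimination. -/
theorem top_elimination_representation :
    (∀ T₁ T₂ : TreeClass,
      topElim ({T₁} : Multiset TreeClass) ∘ₗ topElim ({T₂} : Multiset TreeClass)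
          - topElim ({T₂} : Multiset TreeClass) ∘ₗ topElim ({T₁} : Multiset TreeClass)
        = ∑ T ∈ treeCand (sizeT T₁ + sizeT T₂),
            ((aCount T₁ T₂ T : ℚ) - (aCount T₂ T₁ T : ℚ))
              • topElim ({T} : Multiset TreeClass)) ∧
    (∀ x y : nT, rhoTop (ckBracket x y) = rhoTop x ∘ₗ rhoTop y - rhoTop y ∘ₗ rhoTop x) := by
  exact ⟨topElim_commutator, rhoTop_bracket⟩

end CK
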